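/- arXiv:2204.00473 — 4 statements merged into one kernel-verified Lean document; each statement's English description precedes it below -/
import Mathlib

section
/- Let U, X, Y be Polish metric spaces and let Γ ⊆ Y × X × U be a closed set. For (y,x') ∈ Y × X define Γ_u(y,x') := {(u,x) ∈ U × X : x = x' and (y,x,u) ∈ Γ}, and define the cost c : (U × X) × (Y × X) → [0,∞] by c((u,x),(y,x')) := the extended infimum distance from the point (u,x) to the set Γ_u(y,x') (equal to ∞ when Γ_u(y,x') is empty). Assume c is lower semicontinuous. Let Q be a Borel probability measure on U × X and P a Borel probability measure on Y × X. Then the following are equivalent: (i) there exists a Borel probability measure μ on Y × X × U whose pushforward under (y,x,u) ↦ (y,x) equals P, whose pushforward under (y,x,u) ↦ (u,x) equals Q, and which satisfies μ(Γ) = 1; (ii) the infimum over all couplings π ∈ M(Q,P) of ∫ c dπ (lower Lebesgue integral) equals 0. -/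
open MeasureTheory
open scoped ENNReal

/-- The correspondence `Γ_u`: for `p = (y, x')`, the set of `(u, x)` with `x = x'` and
`(y, x, u) ∈ Γ`. -/
def GammaU {U X Y : Type*} (Γ : Set (Y × X × U)) (p : Y × X) : Set (U × X) :=
  {q : U × X | q.2 = p.2 ∧ (p.1, q.2, q.1) ∈ Γ}

theorem sharp_identified_region_characterization
    {U X Y : Type*}
    [MetricSpace U] [TopologicalSpace.SeparableSpace U] [CompleteSpace U]
    [MeasurableSpace U] [BorelSpace U]
    [MetricSpace X] [TopologicalSpace.SeparableSpace X] [CompleteSpace X]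
    [MeasurableSpace X] [BorelSpace X]
    [MetricSpace Y] [TopologicalSpace.SeparableSpace Y] [CompleteSpace Y]
    [MeasurableSpace Y] [BorelSpace Y]
    (Γ : Set (Y × X × U)) (hΓ : IsClosed Γ)
    (c : (U × X) × (Y × X) → ℝ≥0∞)
    (hc_def : ∀ q : U × X, ∀ p : Y × X, c (q, p) = EMetric.infEdist q (GammaU Γ p))
    (hc : LowerSemicontinuous c)
    (Q : Measure (U × X)) [IsProbabilityMeasure Q]
    (P : Measure (Y × X)) [IsProbabilityMeasure P] :
    (∃ μ : Measure (Y × X × U), IsProbabilityMeasure μ ∧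
        μ.map (fun w : Y × X × U => (w.1, w.2.1)) = P ∧
        μ.map (fun w : Y × X × U => (w.2.2, w.2.1)) = Q ∧
        μ Γ = 1) ↔
    sInf {r : ℝ≥0∞ | ∃ π : Measure ((U × X) × (Y × X)),
        IsProbabilityMeasure π ∧ π.map Prod.fst = Q ∧ π.map Prod.snd = P ∧
        r = ∫⁻ z, c z ∂π} = 0 := by
  have : SecondCountableTopology U := UniformSpace.secondCountable_of_separable U
  have : SecondCountableTopology X := UniformSpace.secondCountable_of_separable X
  have : SecondCountableTopology Y := UniformSpace.secondCountable_of_separable Y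
  have hcm : Measurable c := hc.measurable
  constructor
  · rintro ⟨μ, hμ, hP, hQ, hG⟩
    have hf : Measurable (fun w : Y × X × U => ((w.2.2, w.2.1), (w.1, w.2.1))) := by fun_prop
    refine le_antisymm (sInf_le ?_) bot_le
    refine ⟨μ.map (fun w : Y × X × U => ((w.2.2, w.2.1), (w.1, w.2.1))),
      Measure.isProbabilityMeasure_map hf.aemeasurable, ?_, ?_, ?_⟩
    · rw [Measure.map_map measurable_fst hf]; exact hQ
    · rw [Measure.map_map measurable_snd hf]; exact hP
    · rw [lintegral_map hcm hf]
      symm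
      refine (lintegral_eq_zero_iff (hcm.comp hf)).2 ?_
      have hae : ∀ᵐ w ∂μ, w ∈ Γ := by
        rw [← prob_compl_eq_zero_iff hΓ.measurableSet] at hG
        exact hG
      filter_upwards [hae] with w hw
      simp only [Function.comp_apply, Pi.zero_apply, hc_def]
      exact Metric.infEDist_zero_of_mem ⟨rfl, hw⟩
  · intro h0
    have hex : ∀ n : ℕ, ∃ π : ProbabilityMeasure ((U × X) × (Y × X)),
        (π : Measure ((U × X) × (Y × X))).map Prod.fst = Q ∧ (π : Measure ((U × X) × (Y × X))).map Prod.snd = P ∧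
        ∫⁻ z, c z ∂(π : Measure ((U × X) × (Y × X))) < ((n : ℝ≥0∞))⁻¹ := by
      intro n
      have : sInf {r : ℝ≥0∞ | ∃ π : Measure ((U × X) × (Y × X)),
        IsProbabilityMeasure π ∧ π.map Prod.fst = Q ∧ π.map Prod.snd = P ∧
        r = ∫⁻ z, c z ∂π} < ((n : ℝ≥0∞))⁻¹ := by
        rw [h0]; exact ENNReal.inv_pos.2 (ENNReal.natCast_ne_top n)
      obtain ⟨r, ⟨π, hπ, h1, h2, h3⟩, hr⟩ := sInf_lt_iff.1 this
      exact ⟨⟨π, hπ⟩, h1, h2, h3 ▸ hr⟩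
    choose πs h1 h2 h3 using hex
    have htight : IsTightMeasureSet
        {((μ : ProbabilityMeasure ((U × X) × (Y × X))) : Measure ((U × X) × (Y × X))) | μ ∈ Set.range πs} := by
      apply IsTightMeasureSet.prodMk
      · refine (isTightMeasureSet_singleton (μ := Q)).subset ?_
        rintro _ ⟨_, ⟨_, ⟨n, rfl⟩, rfl⟩, rfl⟩
        exact h1 n
      · refine (isTightMeasureSet_singleton (μ := P)).subset ?_
        rintro _ ⟨_, ⟨_, ⟨n, rfl⟩, rfl⟩, rfl⟩
        exact h2 n
    have hcpt := isCompact_closure_of_isTightMeasureSet htight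
    let L : Ultrafilter ℕ := Ultrafilter.of Filter.atTop
    have hL : (L : Filter ℕ) ≤ Filter.atTop := Ultrafilter.of_le _
    obtain ⟨π, -, hπ⟩ := hcpt.ultrafilter_le_nhds' (L.map πs)
      (Filter.mem_map.2 (Filter.univ_mem' fun n => subset_closure ⟨n, rfl⟩))
    have hlim : Filter.Tendsto πs L (nhds π) := hπ
    have hfst : (π : Measure ((U × X) × (Y × X))).map Prod.fst = Q := by
      have := ProbabilityMeasure.tendsto_map_of_tendsto_of_continuous πs π hlim continuous_fst
      have hcst : (fun i => (πs i).map continuous_fst.measurable.aemeasurable)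
          = fun _ => (⟨Q, inferInstance⟩ : ProbabilityMeasure (U × X)) := by
        funext i; exact Subtype.ext (h1 i)
      rw [hcst] at this
      have heq := tendsto_nhds_unique tendsto_const_nhds this
      exact (congrArg Subtype.val heq).symm
    have hsnd : (π : Measure ((U × X) × (Y × X))).map Prod.snd = P := by
      have := ProbabilityMeasure.tendsto_map_of_tendsto_of_continuous πs π hlim continuous_snd
      have hcst : (fun i => (πs i).map continuous_snd.measurable.aemeasurable)
          = fun _ => (⟨P, inferInstance⟩ : ProbabilityMeasure (Y × X)) := by
        funext i; exact Subtype.ext (h2 i)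
      rw [hcst] at this
      have heq := tendsto_nhds_unique tendsto_const_nhds this
      exact (congrArg Subtype.val heq).symm
    have hsmall : ∀ k : ℕ, ∀ᵐ z ∂(π : Measure ((U × X) × (Y × X))), c z ≤ ((k : ℝ≥0∞))⁻¹ := by
      intro k
      rcases Nat.eq_zero_or_pos k with rfl | hk
      · simp
      have hε0 : ((k : ℝ≥0∞))⁻¹ ≠ 0 := ENNReal.inv_ne_zero.2 (ENNReal.natCast_ne_top k)
      have hεt : ((k : ℝ≥0∞))⁻¹ ≠ ⊤ := ENNReal.inv_ne_top.2 (by exact_mod_cast hk.ne')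
      have hopen : IsOpen {z | ((k : ℝ≥0∞))⁻¹ < c z} := hc.isOpen_preimage _
      have hle := ProbabilityMeasure.le_liminf_measure_open_of_tendsto hlim hopen
      have hb : ∀ n, (πs n : Measure ((U × X) × (Y × X))) {z | ((k : ℝ≥0∞))⁻¹ < c z} ≤
          ((n : ℝ≥0∞))⁻¹ / ((k : ℝ≥0∞))⁻¹ := by
        intro n
        calc _ ≤ (πs n : Measure ((U × X) × (Y × X))) {z | ((k : ℝ≥0∞))⁻¹ ≤ c z} :=
              measure_mono fun z hz => le_of_lt (Set.mem_setOf_eq ▸ hz)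
          _ ≤ _ := meas_ge_le_lintegral_div hcm.aemeasurable hε0 hεt
          _ ≤ _ := ENNReal.div_le_div_right (h3 n).le _
      have hz : Filter.Tendsto (fun n : ℕ => ((n : ℝ≥0∞))⁻¹ / ((k : ℝ≥0∞))⁻¹) Filter.atTop
          (nhds 0) := by
        have := ENNReal.Tendsto.div_const ENNReal.tendsto_inv_nat_nhds_zero
          (b := ((k : ℝ≥0∞))⁻¹) (Or.inr hε0)
        simpa using this
      have ht : Filter.Tendsto (fun n => (πs n : Measure ((U × X) × (Y × X))) {z | ((k : ℝ≥0∞))⁻¹ < c z}) L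
          (nhds 0) :=
        tendsto_of_tendsto_of_tendsto_of_le_of_le tendsto_const_nhds (hz.mono_left hL)
          (fun _ => bot_le) hb
      rw [ht.liminf_eq] at hle
      rw [ae_iff]
      simp only [not_le]
      exact le_antisymm hle bot_le
    have hmem : ∀ᵐ z ∂(π : Measure ((U × X) × (Y × X))), z.1.2 = z.2.2 ∧ (z.2.1, z.1.2, z.1.1) ∈ Γ := by
      filter_upwards [ae_all_iff.2 hsmall] with z hz
      have hz0 : c z = 0 := le_antisymm
        (ge_of_tendsto' ENNReal.tendsto_inv_nat_nhds_zero hz) bot_le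
      have hcl : IsClosed (GammaU Γ z.2) := by
        apply IsClosed.inter
        · exact isClosed_eq continuous_snd continuous_const
        · exact hΓ.preimage (f := fun q : U × X => (z.2.1, q.2, q.1)) (by fun_prop)
      have hz1 : Metric.infEDist z.1 (GammaU Γ z.2) = 0 := (hc_def z.1 z.2).symm.trans hz0
      rw [← Metric.mem_closure_iff_infEDist_zero, hcl.closure_eq] at hz1
      exact hz1
    have hg : Measurable (fun z : (U × X) × (Y × X) => (z.2.1, z.1.2, z.1.1)) := by fun_prop
    have := Measure.isProbabilityMeasure_map (μ := (π : Measure ((U × X) × (Y × X)))) hg.aemeasurable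
    refine ⟨(π : Measure ((U × X) × (Y × X))).map (fun z => (z.2.1, z.1.2, z.1.1)), this, ?_, ?_, ?_⟩
    · rw [Measure.map_map (by fun_prop) hg, ← hsnd]
      refine Measure.map_congr ?_
      filter_upwards [hmem] with z hz
      exact Prod.ext rfl hz.1
    · rw [Measure.map_map (by fun_prop) hg, ← hfst]
      rfl
    · rw [← prob_compl_eq_zero_iff hΓ.measurableSet, Measure.map_apply hg hΓ.measurableSet.compl]
      have := hmem.mono fun z hz => hz.2
      exact this
end

section
/- Let X and Y be Polish metric spaces and c : X × Y → ℝ a bounded continuous nonnegative cost function. If (μ_n) is a sequence of Borel probability measures on X converging weakly to μ, and (ν_n) is a sequence of Borel probability measures on Y converging weakly to ν, then the optimal transport values converge: inf { ∫ c dπ : π ∈ M(μ_n,ν_n) } → inf { ∫ c dπ : π ∈ M(μ,ν) } as n → ∞. -/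
open MeasureTheory Filter
open scoped ENNReal Topology

/-- The optimal transport value between two probability measures with real-valued cost `c`. -/
noncomputable def OTvalR {X Y : Type*} [MeasurableSpace X] [MeasurableSpace Y]
    (μ : Measure X) (ν : Measure Y) (c : X × Y → ℝ) : ℝ :=
  sInf {r : ℝ | ∃ π : Measure (X × Y),
    IsProbabilityMeasure π ∧ π.map Prod.fst = μ ∧ π.map Prod.snd = ν ∧
    r = ∫ z, c z ∂π}

lemma ot_bddBelow {X Y : Type*} [MeasurableSpace X] [MeasurableSpace Y]
    (μ : Measure X) (ν : Measure Y) (c : X × Y → ℝ) (hc : ∀ z, 0 ≤ c z) :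
    BddBelow {r : ℝ | ∃ π : Measure (X × Y),
    IsProbabilityMeasure π ∧ π.map Prod.fst = μ ∧ π.map Prod.snd = ν ∧
    r = ∫ z, c z ∂π} := by
  refine ⟨0, ?_⟩
  rintro r ⟨π, _, _, _, rfl⟩
  exact integral_nonneg hc

lemma ot_fill {X Y : Type*} [MeasurableSpace X] [MeasurableSpace Y]
    (μ : Measure X) (ν : Measure Y) [IsProbabilityMeasure μ] [IsProbabilityMeasure ν]
    (c : X × Y → ℝ) (hcm : Measurable c) (hc : ∀ z, 0 ≤ c z) (M : ℝ) (hM : ∀ z, c z ≤ M)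
    (σ : Measure (X × Y)) [IsFiniteMeasure σ]
    (h1 : σ.map Prod.fst ≤ μ) (h2 : σ.map Prod.snd ≤ ν) :
    OTvalR μ ν c ≤ ∫ z, c z ∂σ + M * (1 - σ.real Set.univ) := by
  have e1 : μ - σ.map Prod.fst + σ.map Prod.fst = μ := Measure.sub_add_cancel_of_le h1
  have e2 : ν - σ.map Prod.snd + σ.map Prod.snd = ν := Measure.sub_add_cancel_of_le h2
  set α := μ - σ.map Prod.fst with hα
  set β := ν - σ.map Prod.snd with hβ
  have s1 : (σ.map Prod.fst) Set.univ = σ Set.univ := by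
    rw [Measure.map_apply measurable_fst MeasurableSet.univ]; simp
  have s2 : (σ.map Prod.snd) Set.univ = σ Set.univ := by
    rw [Measure.map_apply measurable_snd MeasurableSet.univ]; simp
  have a1 : α Set.univ = 1 - σ Set.univ := by
    rw [hα, Measure.sub_apply MeasurableSet.univ h1, s1, measure_univ]
  have b1 : β Set.univ = 1 - σ Set.univ := by
    rw [hβ, Measure.sub_apply MeasurableSet.univ h2, s2, measure_univ]
  set m := 1 - σ Set.univ with hm
  have mtop : m ≠ ∞ := ne_top_of_le_ne_top ENNReal.one_ne_top tsub_le_self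
  have fα : IsFiniteMeasure α := ⟨by rw [a1]; exact lt_of_le_of_ne le_top mtop⟩
  have fβ : IsFiniteMeasure β := ⟨by rw [b1]; exact lt_of_le_of_ne le_top mtop⟩
  set ρ : Measure (X × Y) := m⁻¹ • α.prod β with hρ
  have r1 : ρ.map Prod.fst = α := by
    rw [hρ, Measure.map_smul, Measure.map_fst_prod, b1]
    by_cases h0 : m = 0
    · have : α = 0 := by rw [← Measure.measure_univ_eq_zero, a1, h0]
      simp [this]
    · rw [smul_smul, ENNReal.inv_mul_cancel h0 mtop, one_smul]
  have r2 : ρ.map Prod.snd = β := by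
    rw [hρ, Measure.map_smul, Measure.map_snd_prod, a1]
    by_cases h0 : m = 0
    · have : β = 0 := by rw [← Measure.measure_univ_eq_zero, b1, h0]
      simp [this]
    · rw [smul_smul, ENNReal.inv_mul_cancel h0 mtop, one_smul]
  have ru : ρ Set.univ = m := by
    rw [← a1, ← r1, Measure.map_apply measurable_fst MeasurableSet.univ]; simp
  have fρ : IsFiniteMeasure ρ := ⟨by rw [ru]; exact lt_of_le_of_ne le_top mtop⟩
  have σle : σ Set.univ ≤ 1 := by
    rw [← s1, ← measure_univ (μ := μ)]; exact h1 _
  have hint : ∀ (τ : Measure (X × Y)) [IsFiniteMeasure τ], Integrable c τ := by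
    intro τ _
    refine Integrable.of_bound (C := M) hcm.aestronglyMeasurable (Eventually.of_forall fun z => ?_)
    rw [Real.norm_of_nonneg (hc z)]; exact hM z
  have hle : OTvalR μ ν c ≤ ∫ z, c z ∂(σ + ρ) := by
    refine csInf_le (ot_bddBelow μ ν c hc) ⟨σ + ρ, ⟨?_⟩, ?_, ?_, rfl⟩
    · rw [Measure.add_apply, ru, hm, add_tsub_cancel_of_le σle]
    · rw [Measure.map_add _ _ measurable_fst, r1, add_comm, e1]
    · rw [Measure.map_add _ _ measurable_snd, r2, add_comm, e2]
  rw [integral_add_measure (hint σ) (hint ρ)] at hle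
  have : ∫ z, c z ∂ρ ≤ M * (1 - σ.real Set.univ) := by
    calc ∫ z, c z ∂ρ ≤ ∫ z, M ∂ρ := integral_mono (hint ρ) (integrable_const M) hM
      _ = M * (1 - σ.real Set.univ) := by
        rw [integral_const, smul_eq_mul, mul_comm, Measure.real, ru, hm,
          ENNReal.toReal_sub_of_le σle ENNReal.one_ne_top]
        simp [Measure.real]
  linarith

lemma ot_blocks {X Y : Type*} [MeasurableSpace X] [MeasurableSpace Y]
    (μ : Measure X) (ν : Measure Y) [IsProbabilityMeasure μ] [IsProbabilityMeasure ν]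
    (c : X × Y → ℝ) (hcm : Measurable c) (hc : ∀ z, 0 ≤ c z) (M : ℝ) (hM : ∀ z, c z ≤ M)
    {ι κ : Type*} [Fintype ι] [Fintype κ] (A : ι → Set X) (B : κ → Set Y)
    (hA : ∀ i, MeasurableSet (A i)) (hB : ∀ j, MeasurableSet (B j))
    (dA : Pairwise (Function.onFun Disjoint A)) (dB : Pairwise (Function.onFun Disjoint B))
    (q : ι → κ → ℝ) (hq : ∀ i j, 0 ≤ q i j)
    (q1 : ∀ i, ∑ j, q i j * ν.real (B j) ≤ 1) (q2 : ∀ j, ∑ i, q i j * μ.real (A i) ≤ 1)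
    (C : ι → κ → ℝ) (hC : ∀ i j, ∀ z ∈ A i ×ˢ B j, c z ≤ C i j) :
    OTvalR μ ν c ≤ ∑ i, ∑ j, q i j * (μ.real (A i) * ν.real (B j)) * C i j
      + M * (1 - ∑ i, ∑ j, q i j * (μ.real (A i) * ν.real (B j))) := by
  set s : ι → κ → Measure (X × Y) := fun i j =>
    ENNReal.ofReal (q i j) • (μ.restrict (A i)).prod (ν.restrict (B j)) with hs
  have fs : ∀ i j, IsFiniteMeasure (s i j) := fun i j => by
    simp only [hs]; exact Measure.smul_finite _ ENNReal.ofReal_ne_top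
  set σ : Measure (X × Y) := ∑ i, ∑ j, s i j with hσ
  have su : ∀ i j, (s i j).real Set.univ = q i j * (μ.real (A i) * ν.real (B j)) := by
    intro i j
    simp only [hs, Measure.real, Measure.smul_apply, ← Set.univ_prod_univ, Measure.prod_prod,
      Measure.restrict_apply_univ, smul_eq_mul, ENNReal.toReal_mul,
      ENNReal.toReal_ofReal (hq i j)]
  have hint : ∀ (τ : Measure (X × Y)) [IsFiniteMeasure τ], Integrable c τ := by
    intro τ _
    refine Integrable.of_bound (C := M) hcm.aestronglyMeasurable (Eventually.of_forall fun z => ?_)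
    rw [Real.norm_of_nonneg (hc z)]; exact hM z
  have σu : σ.real Set.univ = ∑ i, ∑ j, q i j * (μ.real (A i) * ν.real (B j)) := by
    simp only [← su]
    simp only [Measure.real, hσ, Measure.finsetSum_apply]
    rw [ENNReal.toReal_sum (fun i _ => by
      exact ENNReal.sum_ne_top.2 fun j _ => measure_ne_top _ _)]
    refine Finset.sum_congr rfl fun i _ => ?_
    rw [ENNReal.toReal_sum (fun j _ => measure_ne_top _ _)]
  have σi : ∫ z, c z ∂σ = ∑ i, ∑ j, ∫ z, c z ∂(s i j) := by
    rw [hσ, integral_finsetSum_measure (fun i _ => hint _)]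
    refine Finset.sum_congr rfl fun i _ => ?_
    rw [integral_finsetSum_measure (fun j _ => hint _)]
  have si : ∀ i j, ∫ z, c z ∂(s i j) ≤ q i j * (μ.real (A i) * ν.real (B j)) * C i j := by
    intro i j
    rw [← su, ← smul_eq_mul, ← integral_const]
    refine integral_mono_ae (hint _) (integrable_const _) ?_
    refine Measure.ae_smul_measure ?_ _
    rw [Measure.prod_restrict]
    filter_upwards [ae_restrict_mem ((hA i).prod (hB j))] with z hz using hC i j z hz
  have m1 : σ.map Prod.fst ≤ μ := by
    refine Measure.le_iff.2 fun S hS => ?_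
    have : ∀ i j, s i j (Prod.fst ⁻¹' S)
        = ENNReal.ofReal (q i j * ν.real (B j)) * μ (S ∩ A i) := by
      intro i j
      rw [← Set.prod_univ]
      simp only [hs, Measure.smul_apply, Measure.prod_prod, Measure.restrict_apply hS,
        Measure.restrict_apply_univ, smul_eq_mul]
      rw [ENNReal.ofReal_mul (hq i j), ofReal_measureReal]; ring
    rw [Measure.map_apply measurable_fst hS, hσ]
    simp only [Measure.finsetSum_apply, this]
    calc _ = ∑ i, ENNReal.ofReal (∑ j, q i j * ν.real (B j)) * μ (S ∩ A i) := by
          refine Finset.sum_congr rfl fun i _ => ?_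
          rw [ENNReal.ofReal_sum_of_nonneg (fun j _ => mul_nonneg (hq i j) measureReal_nonneg),
            Finset.sum_mul]
      _ ≤ ∑ i, μ (S ∩ A i) := by
          refine Finset.sum_le_sum fun i _ => ?_
          refine (mul_le_mul_left (ENNReal.ofReal_le_one.2 (q1 i)) _).trans ?_
          rw [one_mul]
      _ = μ (⋃ i, S ∩ A i) := by
          rw [measure_iUnion (fun i j hij => (dA hij).mono Set.inter_subset_right
            Set.inter_subset_right) (fun i => hS.inter (hA i)), tsum_fintype]
      _ ≤ μ S := measure_mono (Set.iUnion_subset fun i => Set.inter_subset_left)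
  have m2 : σ.map Prod.snd ≤ ν := by
    refine Measure.le_iff.2 fun S hS => ?_
    have : ∀ i j, s i j (Prod.snd ⁻¹' S)
        = ENNReal.ofReal (q i j * μ.real (A i)) * ν (S ∩ B j) := by
      intro i j
      rw [← Set.univ_prod]
      simp only [hs, Measure.smul_apply, Measure.prod_prod, Measure.restrict_apply hS,
        Measure.restrict_apply_univ, smul_eq_mul]
      rw [ENNReal.ofReal_mul (hq i j), ofReal_measureReal]; ring
    rw [Measure.map_apply measurable_snd hS, hσ]
    simp only [Measure.finsetSum_apply, this]
    rw [Finset.sum_comm]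
    calc _ = ∑ j, ENNReal.ofReal (∑ i, q i j * μ.real (A i)) * ν (S ∩ B j) := by
          refine Finset.sum_congr rfl fun j _ => ?_
          rw [ENNReal.ofReal_sum_of_nonneg (fun i _ => mul_nonneg (hq i j) measureReal_nonneg),
            Finset.sum_mul]
      _ ≤ ∑ j, ν (S ∩ B j) := by
          refine Finset.sum_le_sum fun j _ => ?_
          refine (mul_le_mul_left (ENNReal.ofReal_le_one.2 (q2 j)) _).trans ?_
          rw [one_mul]
      _ = ν (⋃ j, S ∩ B j) := by
          rw [measure_iUnion (fun i j hij => (dB hij).mono Set.inter_subset_right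
            Set.inter_subset_right) (fun i => hS.inter (hB i)), tsum_fintype]
      _ ≤ ν S := measure_mono (Set.iUnion_subset fun i => Set.inter_subset_left)
  have := ot_fill μ ν c hcm hc M hM σ m1 m2
  rw [σu, σi] at this
  refine this.trans ?_
  gcongr with i _ j _
  exact si i j

lemma ot_cover {X : Type*} [MetricSpace X] [MeasurableSpace X] [BorelSpace X]
    (μ : Measure X) [IsProbabilityMeasure μ] (K : Set X) (hK : IsCompact K) (r : ℝ) (hr : 0 < r) :
    ∃ (N : ℕ) (A : Fin N → Set X) (x : Fin N → X), (∀ i, x i ∈ K) ∧ (∀ i, MeasurableSet (A i)) ∧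
      Pairwise (Function.onFun Disjoint A) ∧ (∀ i, A i ⊆ Metric.ball (x i) r) ∧
      K ⊆ ⋃ i, A i ∧ ∀ i, μ (frontier (A i)) = 0 := by
  choose ρ hρ hρ0 using fun x : X => exists_null_frontier_thickening μ {x} hr
  simp only [Metric.thickening_singleton] at hρ0
  obtain ⟨t, htK, htc⟩ := hK.elim_nhds_subcover (fun x => Metric.ball x (ρ x))
    (fun x _ => Metric.ball_mem_nhds x (hρ x).1)
  set e := t.equivFin.symm
  set f : Fin t.card → Set X := fun i => Metric.ball (e i) (ρ (e i)) with hf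
  refine ⟨t.card, disjointed f, fun i => e i, fun i => htK _ (e i).2, fun i => ?_,
    disjoint_disjointed f, fun i => ?_, ?_, fun i => ?_⟩
  · refine disjointedRec (p := fun s => MeasurableSet s) ?_ Metric.isOpen_ball.measurableSet
    intro s j h
    exact h.diff Metric.isOpen_ball.measurableSet
  · exact (disjointed_subset f i).trans (Metric.ball_subset_ball (hρ _).2.le)
  · rw [iUnion_disjointed]
    refine htc.trans ?_
    intro z hz
    simp only [Set.mem_iUnion] at hz ⊢
    obtain ⟨x, hx, hz⟩ := hz
    exact ⟨t.equivFin ⟨x, hx⟩, by simpa [hf, e] using hz⟩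
  · refine disjointedRec (p := fun s => μ (frontier s) = 0) ?_ (hρ0 _)
    intro s j h
    rw [Set.sdiff_eq]
    exact null_frontier_inter h (by rw [frontier_compl]; exact hρ0 _)

lemma ot_approx {X Y : Type*}
    [MetricSpace X] [TopologicalSpace.SeparableSpace X] [CompleteSpace X]
    [MeasurableSpace X] [BorelSpace X]
    [MetricSpace Y] [TopologicalSpace.SeparableSpace Y] [CompleteSpace Y]
    [MeasurableSpace Y] [BorelSpace Y]
    (c : X × Y → ℝ) (hc_cont : Continuous c) (π : Measure (X × Y)) [IsProbabilityMeasure π]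
    (μ : Measure X) (ν : Measure Y) [IsProbabilityMeasure μ] [IsProbabilityMeasure ν]
    (h1 : π.map Prod.fst = μ) (h2 : π.map Prod.snd = ν) (δ : ℝ) (hδ : 0 < δ) :
    ∃ (N N' : ℕ) (A : Fin N → Set X) (B : Fin N' → Set Y) (C : Fin N → Fin N' → ℝ),
      (∀ i, MeasurableSet (A i)) ∧ (∀ j, MeasurableSet (B j)) ∧
      Pairwise (Function.onFun Disjoint A) ∧ Pairwise (Function.onFun Disjoint B) ∧
      (∀ i, μ (frontier (A i)) = 0) ∧ (∀ j, ν (frontier (B j)) = 0) ∧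
      (∀ i j, ∀ z ∈ A i ×ˢ B j, c z ≤ C i j ∧ C i j ≤ c z + 2 * δ) ∧
      1 - δ ≤ π.real (⋃ i, ⋃ j, A i ×ˢ B j) := by
  have : SecondCountableTopology X := UniformSpace.secondCountable_of_separable X
  have : SecondCountableTopology Y := UniformSpace.secondCountable_of_separable Y
  have hδ' : 0 < ENNReal.ofReal (δ / 2) := by simpa using hδ
  obtain ⟨K, hK, hKm⟩ := isTightMeasureSet_iff_exists_isCompact_measure_compl_le.1
    (isTightMeasureSet_singleton (μ := μ)) _ hδ'
  obtain ⟨L, hL, hLm⟩ := isTightMeasureSet_iff_exists_isCompact_measure_compl_le.1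
    (isTightMeasureSet_singleton (μ := ν)) _ hδ'
  have hKm := hKm μ rfl
  have hLm := hLm ν rfl
  have huc := (hK.prod hL).uniformContinuousAt_of_continuousAt c
    (fun z _ => hc_cont.continuousAt) (Metric.dist_mem_uniformity hδ)
  obtain ⟨r, hr, hrc⟩ := Metric.mem_uniformity_dist.1 huc
  obtain ⟨N, A, x, hx, hA, dA, bA, cA, fA⟩ := ot_cover μ K hK r hr
  obtain ⟨N', B, y, hy, hB, dB, bB, cB, fB⟩ := ot_cover ν L hL r hr
  refine ⟨N, N', A, B, fun i j => c (x i, y j) + δ, hA, hB, dA, dB, fA, fB, ?_, ?_⟩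
  · rintro i j ⟨a, b⟩ ⟨ha, hb⟩
    have hd : dist (x i, y j) (a, b) < r := by
      rw [dist_comm, Prod.dist_eq]
      exact max_lt (bA i ha) (bB j hb)
    have := hrc hd ⟨hx i, hy j⟩
    simp only [Set.mem_ofPred_eq, Real.dist_eq, abs_lt] at this
    constructor <;> linarith [this.1, this.2]
  · have hsub : (⋃ i, ⋃ j, A i ×ˢ B j)ᶜ ⊆ Prod.fst ⁻¹' Kᶜ ∪ Prod.snd ⁻¹' Lᶜ := by
      rintro ⟨a, b⟩ hab
      by_contra hcon
      simp only [Set.mem_union, Set.mem_preimage, Set.mem_compl_iff, not_or, not_not] at hcon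
      obtain ⟨i, hi⟩ := Set.mem_iUnion.1 (cA hcon.1)
      obtain ⟨j, hj⟩ := Set.mem_iUnion.1 (cB hcon.2)
      exact hab (Set.mem_iUnion.2 ⟨i, Set.mem_iUnion.2 ⟨j, hi, hj⟩⟩)
    have hm : MeasurableSet (⋃ i, ⋃ j, A i ×ˢ B j) :=
      MeasurableSet.iUnion fun i => MeasurableSet.iUnion fun j => (hA i).prod (hB j)
    rw [← h1, Measure.map_apply measurable_fst hK.isClosed.measurableSet.compl] at hKm
    rw [← h2, Measure.map_apply measurable_snd hL.isClosed.measurableSet.compl] at hLm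
    have : π (⋃ i, ⋃ j, A i ×ˢ B j)ᶜ ≤ ENNReal.ofReal δ := by
      calc _ ≤ _ := measure_mono hsub
        _ ≤ _ := measure_union_le _ _
        _ ≤ ENNReal.ofReal (δ / 2) + ENNReal.ofReal (δ / 2) := add_le_add hKm hLm
        _ = ENNReal.ofReal δ := by
          rw [← ENNReal.ofReal_add (by positivity) (by positivity)]; congr 1; ring
    have h3 : π.real (⋃ i, ⋃ j, A i ×ˢ B j)ᶜ ≤ δ := ENNReal.toReal_le_of_le_ofReal hδ.le this
    rw [probReal_compl_eq_one_sub hm] at h3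
    linarith

lemma ot_upper {X Y : Type*}
    [MetricSpace X] [TopologicalSpace.SeparableSpace X] [CompleteSpace X]
    [MeasurableSpace X] [BorelSpace X]
    [MetricSpace Y] [TopologicalSpace.SeparableSpace Y] [CompleteSpace Y]
    [MeasurableSpace Y] [BorelSpace Y]
    (c : X × Y → ℝ) (hc_cont : Continuous c) (hc : ∀ z, 0 ≤ c z)
    (M : ℝ) (hM0 : 0 ≤ M) (hM : ∀ z, c z ≤ M)
    (μs : ℕ → ProbabilityMeasure X) (μ : ProbabilityMeasure X)
    (νs : ℕ → ProbabilityMeasure Y) (ν : ProbabilityMeasure Y)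
    (hμ : Tendsto μs atTop (𝓝 μ)) (hν : Tendsto νs atTop (𝓝 ν))
    (π : Measure (X × Y)) [IsProbabilityMeasure π]
    (h1 : π.map Prod.fst = μ.toMeasure) (h2 : π.map Prod.snd = ν.toMeasure)
    (ε : ℝ) (hε : 0 < ε) :
    ∀ᶠ n in atTop, OTvalR (μs n).toMeasure (νs n).toMeasure c < ∫ z, c z ∂π + ε := by
  have : SecondCountableTopology X := UniformSpace.secondCountable_of_separable X
  have : SecondCountableTopology Y := UniformSpace.secondCountable_of_separable Y
  obtain ⟨δ, hδ, hδ1, hδε⟩ : ∃ δ : ℝ, 0 < δ ∧ δ < 1 ∧ 2 * δ * (1 + M) < ε := by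
    refine ⟨min (1 / 2) (ε / (4 * (1 + M))), by positivity,
      (min_le_left _ _).trans_lt (by norm_num), ?_⟩
    have := min_le_right (1 / 2) (ε / (4 * (1 + M)))
    calc _ ≤ 2 * (ε / (4 * (1 + M))) * (1 + M) := by gcongr
      _ = ε / 2 := by field_simp; norm_num
      _ < ε := by linarith
  obtain ⟨N, N', A, B, C, hA, hB, dA, dB, fA, fB, hC, hmass⟩ :=
    ot_approx c hc_cont π μ.toMeasure ν.toMeasure h1 h2 δ hδ
  have tA : ∀ i, Tendsto (fun n => (μs n).toMeasure.real (A i)) atTop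
      (𝓝 (μ.toMeasure.real (A i))) := fun i =>
    (ENNReal.tendsto_toReal (measure_ne_top _ _)).comp
      (ProbabilityMeasure.tendsto_measure_of_null_frontier_of_tendsto' hμ (fA i))
  have tB : ∀ j, Tendsto (fun n => (νs n).toMeasure.real (B j)) atTop
      (𝓝 (ν.toMeasure.real (B j))) := fun j =>
    (ENNReal.tendsto_toReal (measure_ne_top _ _)).comp
      (ProbabilityMeasure.tendsto_measure_of_null_frontier_of_tendsto' hν (fB j))
  set a : Fin N → ℝ := fun i => μ.toMeasure.real (A i) with ha
  set b : Fin N' → ℝ := fun j => ν.toMeasure.real (B j) with hb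
  set p : Fin N → Fin N' → ℝ := fun i j => π.real (A i ×ˢ B j) with hp
  have a0 : ∀ i, 0 ≤ a i := fun i => measureReal_nonneg
  have b0 : ∀ j, 0 ≤ b j := fun j => measureReal_nonneg
  have p0 : ∀ i j, 0 ≤ p i j := fun i j => measureReal_nonneg
  have ea : ∀ i, π.real (Prod.fst ⁻¹' A i) = a i := fun i => by
    simp only [ha, ← h1, Measure.real, Measure.map_apply measurable_fst (hA i)]
  have eb : ∀ j, π.real (Prod.snd ⁻¹' B j) = b j := fun j => by
    simp only [hb, ← h2, Measure.real, Measure.map_apply measurable_snd (hB j)]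
  have pm : ∀ i j, MeasurableSet (A i ×ˢ B j) := fun i j => (hA i).prod (hB j)
  have pa : ∀ i, ∑ j, p i j ≤ a i := by
    intro i
    rw [← ea, hp, ← measureReal_iUnion_fintype (fun j k hjk => ?_) (fun j => pm i j)]
    · exact measureReal_mono (Set.iUnion_subset fun j => fun z hz => hz.1)
    · exact Set.disjoint_prod.2 (Or.inr (dB hjk))
  have pb : ∀ j, ∑ i, p i j ≤ b j := by
    intro j
    rw [← eb, hp, ← measureReal_iUnion_fintype (fun i k hik => ?_) (fun i => pm i j)]
    · exact measureReal_mono (Set.iUnion_subset fun j => fun z hz => hz.2)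
    · exact Set.disjoint_prod.2 (Or.inl (dA hik))
  have pa0 : ∀ i j, a i = 0 → p i j = 0 := fun i j h =>
    le_antisymm (h ▸ (Finset.single_le_sum (fun j _ => p0 i j) (Finset.mem_univ j)).trans (pa i))
      (p0 i j)
  have pb0 : ∀ i j, b j = 0 → p i j = 0 := fun i j h =>
    le_antisymm (h ▸ (Finset.single_le_sum (fun i _ => p0 i j) (Finset.mem_univ i)).trans (pb j))
      (p0 i j)
  set q : Fin N → Fin N' → ℝ := fun i j => (1 - δ) * (p i j / (a i * b j)) with hq
  have q0 : ∀ i j, 0 ≤ q i j := fun i j =>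
    mul_nonneg (by linarith) (div_nonneg (p0 i j) (mul_nonneg (a0 i) (b0 j)))
  have qab : ∀ i j, q i j * (a i * b j) = (1 - δ) * p i j := by
    intro i j
    by_cases h : a i = 0
    · simp [h, pa0 i j h]
    by_cases h' : b j = 0
    · simp [h', pb0 i j h']
    simp only [hq]; field_simp
  have qb : ∀ i, ∑ j, q i j * b j < 1 := by
    intro i
    have : ∀ j, q i j * b j = (1 - δ) / a i * p i j := by
      intro j
      by_cases h' : b j = 0
      · simp [h', pb0 i j h']
      by_cases h : a i = 0
      · simp [hq, h]
      simp only [hq]; field_simp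
    simp only [this, ← Finset.mul_sum]
    by_cases h : a i = 0
    · simp [h]
    have hpos : 0 < a i := lt_of_le_of_ne (a0 i) (Ne.symm h)
    calc _ ≤ (1 - δ) / a i * a i :=
          mul_le_mul_of_nonneg_left (pa i) (div_nonneg (by linarith) (a0 i))
      _ = 1 - δ := by field_simp
      _ < 1 := by linarith
  have qa : ∀ j, ∑ i, q i j * a i < 1 := by
    intro j
    have : ∀ i, q i j * a i = (1 - δ) / b j * p i j := by
      intro i
      by_cases h' : a i = 0
      · simp [h', pa0 i j h']
      by_cases h : b j = 0
      · simp [hq, h]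
      simp only [hq]; field_simp
    simp only [this, ← Finset.mul_sum]
    by_cases h : b j = 0
    · simp [h]
    have hpos : 0 < b j := lt_of_le_of_ne (b0 j) (Ne.symm h)
    calc _ ≤ (1 - δ) / b j * b j :=
          mul_le_mul_of_nonneg_left (pb j) (div_nonneg (by linarith) (b0 j))
      _ = 1 - δ := by field_simp
      _ < 1 := by linarith
  have E1 : ∀ᶠ n in atTop, ∀ i, ∑ j, q i j * (νs n).toMeasure.real (B j) ≤ 1 := by
    refine eventually_all.2 fun i => ?_
    have : Tendsto (fun n => ∑ j, q i j * (νs n).toMeasure.real (B j)) atTop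
        (𝓝 (∑ j, q i j * b j)) := tendsto_finsetSum _ fun j _ => (tB j).const_mul _
    exact (this.eventually_lt_const (qb i)).mono fun n h => h.le
  have E2 : ∀ᶠ n in atTop, ∀ j, ∑ i, q i j * (μs n).toMeasure.real (A i) ≤ 1 := by
    refine eventually_all.2 fun j => ?_
    have : Tendsto (fun n => ∑ i, q i j * (μs n).toMeasure.real (A i)) atTop
        (𝓝 (∑ i, q i j * a i)) := tendsto_finsetSum _ fun i _ => (tA i).const_mul _
    exact (this.eventually_lt_const (qa j)).mono fun n h => h.le
  have T : Tendsto (fun n => ∑ i, ∑ j, q i j *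
        ((μs n).toMeasure.real (A i) * (νs n).toMeasure.real (B j)) * C i j
      + M * (1 - ∑ i, ∑ j, q i j *
        ((μs n).toMeasure.real (A i) * (νs n).toMeasure.real (B j)))) atTop
      (𝓝 (∑ i, ∑ j, q i j * (a i * b j) * C i j
        + M * (1 - ∑ i, ∑ j, q i j * (a i * b j)))) := by
    have t : ∀ i j, Tendsto (fun n => q i j *
        ((μs n).toMeasure.real (A i) * (νs n).toMeasure.real (B j))) atTop
        (𝓝 (q i j * (a i * b j))) := fun i j => ((tA i).mul (tB j)).const_mul _
    refine Tendsto.add ?_ (Tendsto.const_mul _ (tendsto_const_nhds.sub ?_))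
    · exact tendsto_finsetSum _ fun i _ => tendsto_finsetSum _ fun j _ => (t i j).mul_const _
    · exact tendsto_finsetSum _ fun i _ => tendsto_finsetSum _ fun j _ => t i j
  have hintc : Integrable c π := by
    refine Integrable.of_bound (C := M) hc_cont.measurable.aestronglyMeasurable
      (Eventually.of_forall fun z => ?_)
    rw [Real.norm_of_nonneg (hc z)]; exact hM z
  have hint : Integrable (fun z => c z + 2 * δ) π := hintc.add (integrable_const _)
  have hU : (⋃ i, ⋃ j, A i ×ˢ B j) = ⋃ ij : Fin N × Fin N', A ij.1 ×ˢ B ij.2 := by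
    ext z; simp
  have dP : Pairwise (Function.onFun Disjoint fun ij : Fin N × Fin N' => A ij.1 ×ˢ B ij.2) := by
    rintro ⟨i, j⟩ ⟨i', j'⟩ hne
    refine Set.disjoint_prod.2 ?_
    by_cases h : i = i'
    · exact Or.inr (dB fun h' => hne (Prod.ext h h'))
    · exact Or.inl (dA h)
  have hsum : ∑ i, ∑ j, p i j = π.real (⋃ i, ⋃ j, A i ×ˢ B j) := by
    rw [hU, measureReal_iUnion_fintype dP (fun ij => pm _ _), Fintype.sum_prod_type]
  have hcost : ∑ i, ∑ j, p i j * C i j ≤ ∫ z, c z ∂π + 2 * δ := by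
    have step : ∀ i j, p i j * C i j ≤ ∫ z in A i ×ˢ B j, (c z + 2 * δ) ∂π := by
      intro i j
      rw [hp, ← smul_eq_mul, ← setIntegral_const]
      exact setIntegral_mono_on (integrable_const _).integrableOn hint.integrableOn (pm i j)
        fun z hz => (hC i j z hz).2
    calc _ ≤ ∑ i, ∑ j, ∫ z in A i ×ˢ B j, (c z + 2 * δ) ∂π := by gcongr with i _ j _; exact step i j
      _ = ∫ z in ⋃ ij : Fin N × Fin N', A ij.1 ×ˢ B ij.2, (c z + 2 * δ) ∂π := by
          rw [integral_iUnion_fintype (fun ij => pm _ _) dP (fun ij => hint.integrableOn),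
            Fintype.sum_prod_type]
      _ ≤ ∫ z, (c z + 2 * δ) ∂π :=
          setIntegral_le_integral hint (Eventually.of_forall fun z => by
            have := hc z
            simp only [Pi.zero_apply]; positivity)
      _ = _ := by rw [integral_add hintc (integrable_const _)]; simp
  have R : ∑ i, ∑ j, q i j * (a i * b j) * C i j
        + M * (1 - ∑ i, ∑ j, q i j * (a i * b j)) < ∫ z, c z ∂π + ε := by
    have I0 : 0 ≤ ∫ z, c z ∂π := integral_nonneg hc
    simp only [qab, mul_assoc, ← Finset.mul_sum]
    rw [hsum]
    have k1 : (1 - δ) * ∑ i, ∑ j, p i j * C i j ≤ ∫ z, c z ∂π + 2 * δ := by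
      calc _ ≤ (1 - δ) * (∫ z, c z ∂π + 2 * δ) :=
            mul_le_mul_of_nonneg_left hcost (by linarith)
        _ ≤ 1 * (∫ z, c z ∂π + 2 * δ) := by gcongr; linarith
        _ = _ := one_mul _
    have k2 : 1 - (1 - δ) * π.real (⋃ i, ⋃ j, A i ×ˢ B j) ≤ 2 * δ := by nlinarith
    have k3 := mul_le_mul_of_nonneg_left k2 hM0
    linarith
  filter_upwards [E1, E2, T.eventually_lt_const R] with n e1 e2 e3
  exact (ot_blocks (μs n).toMeasure (νs n).toMeasure c hc_cont.measurable hc M hM A B hA hB dA dB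
    q q0 e1 e2 C (fun i j z hz => (hC i j z hz).1)).trans_lt e3

lemma ot_nonempty {X Y : Type*} [MeasurableSpace X] [MeasurableSpace Y]
    (μ : Measure X) (ν : Measure Y) [IsProbabilityMeasure μ] [IsProbabilityMeasure ν]
    (c : X × Y → ℝ) : {r : ℝ | ∃ π : Measure (X × Y),
    IsProbabilityMeasure π ∧ π.map Prod.fst = μ ∧ π.map Prod.snd = ν ∧
    r = ∫ z, c z ∂π}.Nonempty :=
  ⟨_, μ.prod ν, inferInstance, by simp [Measure.map_fst_prod], by simp [Measure.map_snd_prod], rfl⟩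

lemma ot_exists_lt {X Y : Type*} [MeasurableSpace X] [MeasurableSpace Y]
    (μ : Measure X) (ν : Measure Y) [IsProbabilityMeasure μ] [IsProbabilityMeasure ν]
    (c : X × Y → ℝ) (r : ℝ) (hr : OTvalR μ ν c < r) : ∃ π : ProbabilityMeasure (X × Y),
      π.toMeasure.map Prod.fst = μ ∧ π.toMeasure.map Prod.snd = ν ∧ ∫ z, c z ∂π.toMeasure < r := by
  obtain ⟨_, ⟨π, h, h1, h2, rfl⟩, h3⟩ := exists_lt_of_csInf_lt (ot_nonempty μ ν c) hr
  exact ⟨⟨π, h⟩, h1, h2, h3⟩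

lemma ot_tight {X : Type*} [MetricSpace X] [TopologicalSpace.SeparableSpace X] [CompleteSpace X]
    [MeasurableSpace X] [BorelSpace X]
    (μs : ℕ → ProbabilityMeasure X) (μ : ProbabilityMeasure X) (hμ : Tendsto μs atTop (𝓝 μ)) :
    IsTightMeasureSet {x : Measure X | ∃ n, (μs n).toMeasure = x} := by
  have : SecondCountableTopology X := UniformSpace.secondCountable_of_separable X
  have h := hμ.isCompact_insert_range
  have h2 : IsCompact (closure (insert μ (Set.range μs))) := by
    rwa [h.isClosed.closure_eq]
  refine (isTightMeasureSet_of_isCompact_closure h2).subset ?_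
  rintro _ ⟨n, rfl⟩
  exact ⟨μs n, Or.inr ⟨n, rfl⟩, rfl⟩

lemma ot_lower {X Y : Type*}
    [MetricSpace X] [TopologicalSpace.SeparableSpace X] [CompleteSpace X]
    [MeasurableSpace X] [BorelSpace X]
    [MetricSpace Y] [TopologicalSpace.SeparableSpace Y] [CompleteSpace Y]
    [MeasurableSpace Y] [BorelSpace Y]
    (c : X × Y → ℝ) (hc_cont : Continuous c) (hc : ∀ z, 0 ≤ c z)
    (M : ℝ) (hM : ∀ z, c z ≤ M)
    (μs : ℕ → ProbabilityMeasure X) (μ : ProbabilityMeasure X)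
    (νs : ℕ → ProbabilityMeasure Y) (ν : ProbabilityMeasure Y)
    (hμ : Tendsto μs atTop (𝓝 μ)) (hν : Tendsto νs atTop (𝓝 ν))
    (r : ℝ) (hr : r < OTvalR μ.toMeasure ν.toMeasure c) :
    ∀ᶠ n in atTop, r < OTvalR (μs n).toMeasure (νs n).toMeasure c := by
  have : SecondCountableTopology X := UniformSpace.secondCountable_of_separable X
  have : SecondCountableTopology Y := UniformSpace.secondCountable_of_separable Y
  by_contra hcon
  obtain ⟨r', hr1, hr2⟩ := exists_between hr
  have hfreq : ∃ᶠ n in atTop, OTvalR (μs n).toMeasure (νs n).toMeasure c < r' := by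
    rw [not_eventually] at hcon
    exact hcon.mono fun n h => (not_lt.1 h).trans_lt hr1
  have hne : NeBot (atTop ⊓ 𝓟 {n : ℕ | OTvalR (μs n).toMeasure (νs n).toMeasure c < r'}) :=
    frequently_mem_iff_neBot.1 hfreq
  set F := Ultrafilter.of
    (atTop ⊓ 𝓟 {n : ℕ | OTvalR (μs n).toMeasure (νs n).toMeasure c < r'}) with hF
  have hFle := Ultrafilter.of_le
    (atTop ⊓ 𝓟 {n : ℕ | OTvalR (μs n).toMeasure (νs n).toMeasure c < r'})
  have hFa : (F : Filter ℕ) ≤ atTop := hFle.trans inf_le_left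
  have hFb : ∀ᶠ n in (F : Filter ℕ), OTvalR (μs n).toMeasure (νs n).toMeasure c < r' :=
    (hFle.trans inf_le_right) (mem_principal_self _)
  have hch : ∀ n, ∃ π : ProbabilityMeasure (X × Y),
      π.toMeasure.map Prod.fst = (μs n).toMeasure ∧ π.toMeasure.map Prod.snd = (νs n).toMeasure ∧
      (OTvalR (μs n).toMeasure (νs n).toMeasure c < r' → ∫ z, c z ∂π.toMeasure < r') := by
    intro n
    by_cases h : OTvalR (μs n).toMeasure (νs n).toMeasure c < r'
    · obtain ⟨π, h1, h2, h3⟩ := ot_exists_lt _ _ c r' h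
      exact ⟨π, h1, h2, fun _ => h3⟩
    · exact ⟨(μs n).prod (νs n), by simp [Measure.map_fst_prod], by simp [Measure.map_snd_prod],
        fun h' => absurd h' h⟩
  choose π p1 p2 p3 using hch
  have tight : IsTightMeasureSet
      {((ρ : ProbabilityMeasure (X × Y)) : Measure (X × Y)) | ρ ∈ Set.range π} := by
    refine IsTightMeasureSet.prodMk ((ot_tight μs μ hμ).subset ?_) ((ot_tight νs ν hν).subset ?_)
    · rintro _ ⟨_, ⟨_, ⟨n, rfl⟩, rfl⟩, rfl⟩
      exact ⟨n, (p1 n).symm⟩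
    · rintro _ ⟨_, ⟨_, ⟨n, rfl⟩, rfl⟩, rfl⟩
      exact ⟨n, (p2 n).symm⟩
  have hcomp := isCompact_closure_of_isTightMeasureSet tight
  obtain ⟨ρ, -, hρ⟩ := hcomp.ultrafilter_le_nhds (F.map π) (by
    rw [le_principal_iff]
    exact Filter.mem_map.2 (Eventually.of_forall fun n => subset_closure ⟨n, rfl⟩))
  have hT : Tendsto π F (𝓝 ρ) := hρ
  have e1 : ρ.map measurable_fst.aemeasurable = μ := by
    refine tendsto_nhds_unique (ProbabilityMeasure.tendsto_map_of_tendsto_of_continuous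
      π ρ hT continuous_fst) ?_
    refine (hμ.mono_left hFa).congr fun n => ?_
    exact Subtype.ext (p1 n).symm
  have e2 : ρ.map measurable_snd.aemeasurable = ν := by
    refine tendsto_nhds_unique (ProbabilityMeasure.tendsto_map_of_tendsto_of_continuous
      π ρ hT continuous_snd) ?_
    refine (hν.mono_left hFa).congr fun n => ?_
    exact Subtype.ext (p2 n).symm
  let cb : BoundedContinuousFunction (X × Y) ℝ :=
    BoundedContinuousFunction.ofNormedAddCommGroup c hc_cont M
      (fun z => by rw [Real.norm_of_nonneg (hc z)]; exact hM z)
  have hI : Tendsto (fun n => ∫ z, c z ∂(π n).toMeasure) F (𝓝 (∫ z, c z ∂ρ.toMeasure)) :=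
    ProbabilityMeasure.tendsto_iff_forall_integral_tendsto.1 hT cb
  have hle : ∫ z, c z ∂ρ.toMeasure ≤ r' :=
    le_of_tendsto hI (hFb.mono fun n h => (p3 n h).le)
  have hge : OTvalR μ.toMeasure ν.toMeasure c ≤ ∫ z, c z ∂ρ.toMeasure :=
    csInf_le (ot_bddBelow _ _ c hc) ⟨ρ.toMeasure, inferInstance,
      congrArg ProbabilityMeasure.toMeasure e1, congrArg ProbabilityMeasure.toMeasure e2, rfl⟩
  linarith

theorem optimal_transport_value_weakly_continuous
    {X Y : Type*}
    [MetricSpace X] [TopologicalSpace.SeparableSpace X] [CompleteSpace X]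
    [MeasurableSpace X] [BorelSpace X]
    [MetricSpace Y] [TopologicalSpace.SeparableSpace Y] [CompleteSpace Y]
    [MeasurableSpace Y] [BorelSpace Y]
    (c : X × Y → ℝ) (hc_cont : Continuous c) (hc_nonneg : ∀ z, 0 ≤ c z)
    (hc_bdd : ∃ M : ℝ, ∀ z, c z ≤ M)
    (μs : ℕ → ProbabilityMeasure X) (μ : ProbabilityMeasure X)
    (νs : ℕ → ProbabilityMeasure Y) (ν : ProbabilityMeasure Y)
    (hμ : Tendsto μs atTop (𝓝 μ)) (hν : Tendsto νs atTop (𝓝 ν)) :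
    Tendsto (fun n => OTvalR (μs n).toMeasure (νs n).toMeasure c) atTop
      (𝓝 (OTvalR μ.toMeasure ν.toMeasure c)) := by
  obtain ⟨M₀, hM₀⟩ := hc_bdd
  have hM : ∀ z, c z ≤ max M₀ 0 := fun z => (hM₀ z).trans (le_max_left _ _)
  refine tendsto_order.2 ⟨fun r hr => ?_, fun r hr => ?_⟩
  · exact ot_lower c hc_cont hc_nonneg _ hM μs μ νs ν hμ hν r hr
  · obtain ⟨π, h1, h2, h3⟩ := ot_exists_lt _ _ c r hr
    have := ot_upper c hc_cont hc_nonneg _ (le_max_right _ _) hM μs μ νs ν hμ hν π.toMeasure h1 h2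
      (r - ∫ z, c z ∂π.toMeasure) (by linarith)
    exact this.mono fun n hn => by linarith
end

section
/- Let X and Y be Polish metric spaces and c : X × Y → [0,∞] a lower semicontinuous cost function. If (μ_n) is a sequence of Borel probability measures on X converging weakly to μ, and (ν_n) is a sequence of Borel probability measures on Y converging weakly to ν, then the optimal transport value is lower semicontinuous along the sequence: inf { ∫ c dπ : π ∈ M(μ,ν) } ≤ liminf_{n→∞} inf { ∫ c dπ : π ∈ M(μ_n,ν_n) } (lower Lebesgue integrals). -/
open MeasureTheory Filter
open scoped ENNReal Topology

/-- The optimal transport value between two probability measures with cost `c` valued in `ℝ≥0∞`. -/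
noncomputable def OTvalE {X Y : Type*} [MeasurableSpace X] [MeasurableSpace Y]
    (μ : Measure X) (ν : Measure Y) (c : X × Y → ℝ≥0∞) : ℝ≥0∞ :=
  sInf {r : ℝ≥0∞ | ∃ π : Measure (X × Y),
    IsProbabilityMeasure π ∧ π.map Prod.fst = μ ∧ π.map Prod.snd = ν ∧
    r = ∫⁻ z, c z ∂π}

lemma lsc_trunc_aux {Ω : Type*} [MeasurableSpace Ω] [TopologicalSpace Ω] [OpensMeasurableSpace Ω]
    {μ : Measure Ω} {μs : ℕ → Measure Ω} {c : Ω → ℝ≥0∞} (hc : LowerSemicontinuous c)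
    (h_opens : ∀ G, IsOpen G → μ G ≤ atTop.liminf (fun i ↦ μs i G)) (k : ℕ) :
    ∫⁻ x, min (c x) k ∂μ ≤ atTop.liminf (fun i ↦ ∫⁻ x, min (c x) k ∂(μs i)) := by
  have hne : ∀ x, min (c x) (k : ℝ≥0∞) ≠ ∞ := fun x =>
    ne_top_of_le_ne_top (ENNReal.natCast_ne_top k) (min_le_right _ _)
  set f : Ω → ℝ := fun x => (min (c x) (k : ℝ≥0∞)).toReal with hf
  have hfm : Measurable f := (hc.measurable.min measurable_const).ennreal_toReal
  have hfnn : ∀ x, 0 ≤ f x := fun x => ENNReal.toReal_nonneg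
  have hcf : ∀ x, min (c x) (k : ℝ≥0∞) = ENNReal.ofReal (f x) := fun x =>
    (ENNReal.ofReal_toReal (hne x)).symm
  simp_rw [hcf]
  simp_rw [fun m : Measure Ω => lintegral_eq_lintegral_meas_lt m (Eventually.of_forall hfnn)
    hfm.aemeasurable]
  refine le_trans (setLIntegral_mono' measurableSet_Ioi fun t ht => ?_)
    (lintegral_liminf_le (fun n ↦ Antitone.measurable (fun s t hst ↦
            measure_mono (fun ω hω ↦ lt_of_le_of_lt hst hω))))
  refine h_opens _ ?_
  have : {a | t < f a} = if ENNReal.ofReal t < k then c ⁻¹' Set.Ioi (ENNReal.ofReal t) else ∅ := by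
    ext a
    have h1 : t < f a ↔ ENNReal.ofReal t < min (c a) k :=
      (ENNReal.ofReal_lt_iff_lt_toReal (le_of_lt ht) (hne a)).symm
    change t < f a ↔ _
    rw [h1, lt_min_iff]
    split_ifs with h <;> simp [h]
  rw [this]
  split_ifs
  · exact hc.isOpen_preimage _
  · exact isOpen_empty

lemma lsc_lintegral_aux {Ω : Type*} [MeasurableSpace Ω] [TopologicalSpace Ω]
    [OpensMeasurableSpace Ω]
    {μ : Measure Ω} {μs : ℕ → Measure Ω} {c : Ω → ℝ≥0∞} (hc : LowerSemicontinuous c)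
    (h_opens : ∀ G, IsOpen G → μ G ≤ atTop.liminf (fun i ↦ μs i G)) :
    ∫⁻ x, c x ∂μ ≤ atTop.liminf (fun i ↦ ∫⁻ x, c x ∂(μs i)) := by
  have h : ∀ x, c x = ⨆ k : ℕ, min (c x) (k : ℝ≥0∞) := fun x => by
    rw [← inf_iSup_eq, ENNReal.iSup_natCast]; simp
  calc ∫⁻ x, c x ∂μ = ∫⁻ x, ⨆ k : ℕ, min (c x) (k : ℝ≥0∞) ∂μ := lintegral_congr h
    _ = ⨆ k : ℕ, ∫⁻ x, min (c x) (k : ℝ≥0∞) ∂μ :=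
      lintegral_iSup (fun k => hc.measurable.min measurable_const)
        (fun i j hij x => min_le_min le_rfl (by exact_mod_cast hij))
    _ ≤ _ := iSup_le fun k => (lsc_trunc_aux hc h_opens k).trans
      (liminf_le_liminf (Eventually.of_forall fun i => lintegral_mono fun x => min_le_left _ _))

lemma tight_aux {X : Type*} [MetricSpace X] [TopologicalSpace.SeparableSpace X] [CompleteSpace X]
    [MeasurableSpace X] [BorelSpace X] (μs : ℕ → ProbabilityMeasure X) (μ : ProbabilityMeasure X)
    (hμ : Tendsto μs atTop (𝓝 μ)) :
    IsTightMeasureSet {((m : ProbabilityMeasure X) : Measure X) | m ∈ Set.range μs} := by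
  have : SecondCountableTopology X := UniformSpace.secondCountable_of_separable X
  apply isTightMeasureSet_of_isCompact_closure
  exact hμ.isCompact_insert_range.closure_of_subset (Set.subset_insert _ _)

theorem optimal_transport_value_lsc_along_sequence
    {X Y : Type*}
    [MetricSpace X] [TopologicalSpace.SeparableSpace X] [CompleteSpace X]
    [MeasurableSpace X] [BorelSpace X]
    [MetricSpace Y] [TopologicalSpace.SeparableSpace Y] [CompleteSpace Y]
    [MeasurableSpace Y] [BorelSpace Y]
    (c : X × Y → ℝ≥0∞) (hc : LowerSemicontinuous c)
    (μs : ℕ → ProbabilityMeasure X) (μ : ProbabilityMeasure X)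
    (νs : ℕ → ProbabilityMeasure Y) (ν : ProbabilityMeasure Y)
    (hμ : Tendsto μs atTop (𝓝 μ)) (hν : Tendsto νs atTop (𝓝 ν)) :
    OTvalE μ.toMeasure ν.toMeasure c ≤
      Filter.liminf (fun n => OTvalE (μs n).toMeasure (νs n).toMeasure c) atTop := by
  have : SecondCountableTopology X := UniformSpace.secondCountable_of_separable X
  have : SecondCountableTopology Y := UniformSpace.secondCountable_of_separable Y
  by_contra! hlt
  obtain ⟨b, hb1, hb2⟩ := exists_between hlt
  have hfreq := frequently_lt_of_liminf_lt (by isBoundedDefault) hb1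
  obtain ⟨φ, hφ, hφb⟩ := extraction_of_frequently_atTop hfreq
  have hex : ∀ n, ∃ π : ProbabilityMeasure (X × Y),
      π.toMeasure.map Prod.fst = (μs (φ n)).toMeasure ∧
      π.toMeasure.map Prod.snd = (νs (φ n)).toMeasure ∧ ∫⁻ z, c z ∂π.toMeasure < b := by
    intro n
    obtain ⟨r, ⟨π, hp, h1, h2, rfl⟩, hr⟩ := sInf_lt_iff.1 (hφb n)
    exact ⟨⟨π, hp⟩, h1, h2, hr⟩
  choose π h1 h2 h3 using hex
  have ht : IsTightMeasureSet
      {((m : ProbabilityMeasure (X × Y)) : Measure (X × Y)) | m ∈ Set.range π} := by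
    apply IsTightMeasureSet.prodMk
    · refine (tight_aux μs μ hμ).subset ?_
      rintro _ ⟨_, ⟨_, ⟨n, rfl⟩, rfl⟩, rfl⟩
      exact ⟨_, ⟨φ n, rfl⟩, (h1 n).symm⟩
    · refine (tight_aux νs ν hν).subset ?_
      rintro _ ⟨_, ⟨_, ⟨n, rfl⟩, rfl⟩, rfl⟩
      exact ⟨_, ⟨φ n, rfl⟩, (h2 n).symm⟩
  obtain ⟨p, -, ψ, hψ, hlim⟩ := (isCompact_closure_of_isTightMeasureSet ht).isSeqCompact
    (fun n => subset_closure (Set.mem_range_self n))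
  have hsub : Tendsto (φ ∘ ψ) atTop atTop := hφ.tendsto_atTop.comp hψ.tendsto_atTop
  have m1 : p.map (continuous_fst.measurable.aemeasurable) = μ := by
    refine tendsto_nhds_unique
      (ProbabilityMeasure.tendsto_map_of_tendsto_of_continuous _ _ hlim continuous_fst) ?_
    refine (hμ.comp hsub).congr fun n => ?_
    apply ProbabilityMeasure.toMeasure_injective
    exact (h1 (ψ n)).symm
  have m2 : p.map (continuous_snd.measurable.aemeasurable) = ν := by
    refine tendsto_nhds_unique
      (ProbabilityMeasure.tendsto_map_of_tendsto_of_continuous _ _ hlim continuous_snd) ?_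
    refine (hν.comp hsub).congr fun n => ?_
    apply ProbabilityMeasure.toMeasure_injective
    exact (h2 (ψ n)).symm
  have hle : ∫⁻ z, c z ∂p.toMeasure ≤ b := by
    refine (lsc_lintegral_aux hc (fun G hG =>
      ProbabilityMeasure.le_liminf_measure_open_of_tendsto hlim hG)).trans ?_
    refine (liminf_le_liminf (v := fun _ : ℕ => b)
      (Eventually.of_forall fun n => (h3 (ψ n)).le)).trans ?_
    simp
  refine absurd (lt_of_lt_of_le hb2 ?_) (lt_irrefl b)
  refine le_trans ?_ hle
  unfold OTvalE
  apply sInf_le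
  exact ⟨p.toMeasure, inferInstance, congrArg ProbabilityMeasure.toMeasure m1,
    congrArg ProbabilityMeasure.toMeasure m2, rfl⟩
end

section
/- Let S ≥ 1, let a_1,…,a_S be real numbers, and let δ ≥ 0. Then there exists an entry profile y ∈ {0,1}^S that is a pure-strategy Nash equilibrium of the entry game, i.e., for every player s ∈ {1,…,S}: (−1)^{y_s} ( a_s − δ · Σ_{s' ≠ s} y_{s'} ) ≤ 0; equivalently, y_s = 1 implies a_s ≥ δ · (number of entrants other than s), and y_s = 0 implies a_s ≤ δ · (number of entrants other than s). -/
open scoped BigOperators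

theorem entry_game_pure_strategy_nash_equilibrium_exists
    (S : ℕ) (hS : 1 ≤ S) (a : Fin S → ℝ) (δ : ℝ) (hδ : 0 ≤ δ) :
    ∃ y : Fin S → ℕ, (∀ s, y s ≤ 1) ∧
      ∀ s : Fin S,
        (-1 : ℝ) ^ (y s) *
          (a s - δ * ∑ s' ∈ Finset.univ.erase s, (y s' : ℝ)) ≤ 0 := by
  obtain ⟨T, hT⟩ := Finite.exists_max (fun T : Finset (Fin S) =>
    ∑ s ∈ T, a s - δ * ((T.card : ℝ) * ((T.card : ℝ) - 1) / 2))
  refine ⟨fun s => if s ∈ T then 1 else 0, fun s => by dsimp only; split_ifs <;> simp, ?_⟩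
  intro s
  have hsum : ∑ s' ∈ Finset.univ.erase s, (((if s' ∈ T then 1 else 0 : ℕ)) : ℝ)
      = ((T.erase s).card : ℝ) := by
    rw [← Nat.cast_sum, Finset.sum_ite, Finset.sum_const_zero, add_zero, ← Finset.card_eq_sum_ones]
    congr 2
    ext x
    simp
  rw [hsum]
  by_cases hs : s ∈ T
  · have h := hT (T.erase s)
    have h1 := Finset.add_sum_erase T a hs
    have h2 : ((T.erase s).card : ℝ) + 1 = T.card := by
      exact_mod_cast Finset.card_erase_add_one hs
    simp only [hs, if_true]
    rw [← h1, ← h2] at h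
    linarith
  · have h := hT (insert s T)
    simp only [Finset.sum_insert hs, Finset.card_insert_of_notMem hs] at h
    simp only [hs, if_false, Finset.erase_eq_of_notMem hs]
    push_cast at h
    linarith
end
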